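/- For every integer k ≥ 1, E_H(k) = E_H(1) = {id_H, ι}; that is, an automorphism σ of H acts trivially on J/J^{k+1} if and only if σ is the identity or the inversion automorphism ι. -/

import Mathlib

set_option synthInstance.maxHeartbeats 1000000
set_option maxHeartbeats 1000000

noncomputable section

abbrev SL2 : Type := Matrix.SpecialLinearGroup (Fin 2) ℂ

/-- The free abelian group of rank `n`, written multiplicatively. -/
abbrev H (n : ℕ) : Type := Multiplicative (Fin n → ℤ)

/-- The algebra of complex-valued functions on the representation space `R(H)`. -/
abbrev FR (n : ℕ) : Type := (H n →* SL2) → ℂ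

/-- The standard basis element `x_i` of `H`. -/
def xgen (n : ℕ) (i : Fin n) : H n := Multiplicative.ofAdd (Pi.single i 1)

/-- The Fricke character `tr x`. -/
def trc {n : ℕ} (x : H n) : FR n :=
  fun ρ => Matrix.trace ((ρ x : Matrix (Fin 2) (Fin 2) ℂ))

/-- The ring of Fricke characters `𝔛_ℚ(H)`. -/
def Xring (n : ℕ) : Subalgebra ℚ (FR n) :=
  Algebra.adjoin ℚ {f : FR n | ∃ x : H n, f = trc x}

/-- The ideal `J` generated by all `tr' x = tr x - 2`. -/
def Jideal (n : ℕ) : Ideal (Xring n) :=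
  Ideal.span {f : Xring n | ∃ x : H n, (f : FR n) = trc x - 2}

/-- `tr' x = tr x - 2` as an element of `𝔛_ℚ(H)`. -/
def trc' {n : ℕ} (x : H n) : Xring n :=
  ⟨trc x - 2, sub_mem (Algebra.subset_adjoin ⟨x, rfl⟩) (ofNat_mem _ 2)⟩

/-- The right action of `σ ∈ Aut(H)` on `F(R(H),ℂ)`: `χ^σ(ρ) := χ(ρ^{σ⁻¹})`, i.e.
`χ^σ = fun ρ => χ (ρ ∘ σ)`, as a ring homomorphism. -/
def actRH (n : ℕ) (σ : MulAut (H n)) : FR n →+* FR n where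
  toFun χ := fun ρ => χ (ρ.comp σ.toMonoidHom)
  map_one' := rfl
  map_mul' _ _ := rfl
  map_zero' := rfl
  map_add' _ _ := rfl

/-- `E_H(k)`: the set of automorphisms of `H` acting trivially on `J/J^{k+1}`, i.e. those `σ`
with `f^σ - f ∈ J^{k+1}` for every `f ∈ J`. -/
def EH (n k : ℕ) : Set (MulAut (H n)) :=
  {σ | ∀ f : Xring n, f ∈ Jideal n →
    actRH n σ (f : FR n) - (f : FR n) ∈
      Subtype.val '' ((Jideal n ^ (k + 1) : Ideal (Xring n)) : Set (Xring n))}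

/-- The inversion automorphism `ι : x_i ↦ x_i⁻¹`. -/
def inv_aut (n : ℕ) : MulAut (H n) := MulEquiv.inv (H n)

open Filter Topology

/-- The value at `x` of the linear form on `ℤⁿ` with complex coefficients `a`. -/
def pairing {n : ℕ} (a : Fin n → ℂ) (x : H n) : ℂ := ∑ i, a i * (x.toAdd i : ℂ)

lemma pairing_one {n : ℕ} (a : Fin n → ℂ) : pairing a 1 = 0 := by simp [pairing]

lemma pairing_mul {n : ℕ} (a : Fin n → ℂ) (x y : H n) :
    pairing a (x * y) = pairing a x + pairing a y := by
  simp [pairing, mul_add, Finset.sum_add_distrib]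

lemma pairing_smul {n : ℕ} (t : ℂ) (a : Fin n → ℂ) (x : H n) :
    pairing (t • a) x = t * pairing a x := by
  simp [pairing, Finset.mul_sum, mul_assoc]

lemma pairing_single {n : ℕ} (i : Fin n) (x : H n) :
    pairing (Pi.single i 1) x = x.toAdd i := by
  simp [pairing, Pi.single_apply]

lemma pairing_add {n : ℕ} (a b : Fin n → ℂ) (x : H n) :
    pairing (a + b) x = pairing a x + pairing b x := by
  simp [pairing, add_mul, Finset.sum_add_distrib]

/-- The diagonal representation `x ↦ diag (exp ⟨a, x⟩, exp (-⟨a, x⟩))`. -/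
def diagRep {n : ℕ} (a : Fin n → ℂ) : H n →* SL2 where
  toFun x := ⟨!![Complex.exp (pairing a x), 0; 0, Complex.exp (-pairing a x)], by
    simp [Matrix.det_fin_two, ← Complex.exp_add]⟩
  map_one' := by
    ext i j
    fin_cases i <;> fin_cases j <;> simp [pairing_one]
  map_mul' x y := by
    apply Subtype.ext
    change !![_, _; _, _] = !![_, _; _, _] * !![_, _; _, _]
    simp [pairing_mul, Complex.exp_add, mul_comm]

lemma trc_diagRep {n : ℕ} (a : Fin n → ℂ) (x : H n) :
    trc x (diagRep a) = Complex.exp (pairing a x) + Complex.exp (-pairing a x) := by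
  change Matrix.trace !![_, _; _, _] = _
  rw [Matrix.trace_fin_two_of]

lemma tendsto_exp_add_exp_neg_sub_two_div_sq (c : ℂ) :
    Tendsto (fun t : ℂ => (Complex.exp (t * c) + Complex.exp (-(t * c)) - 2) / t ^ 2)
      (𝓝[≠] 0) (𝓝 (c ^ 2)) := by
  have h : HasDerivAt (fun t : ℂ => Complex.exp (t * (c / 2)) - Complex.exp (-(t * (c / 2))))
      c 0 := by
    have h1 : HasDerivAt (fun t : ℂ => t * (c / 2)) (c / 2) 0 := by
      simpa using (hasDerivAt_id (0 : ℂ)).mul_const (c / 2)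
    exact (h1.cexp.sub h1.neg.cexp).congr_deriv (by simp)
  refine ((hasDerivAt_iff_tendsto_slope.1 h).pow 2).congr fun t => ?_
  have e1 : Complex.exp (t * c) = Complex.exp (t * (c / 2)) ^ 2 := by
    rw [← Complex.exp_nat_mul]; congr 1; push_cast; ring
  have e2 : Complex.exp (-(t * c)) = Complex.exp (-(t * (c / 2))) ^ 2 := by
    rw [← Complex.exp_nat_mul]; congr 1; push_cast; ring
  have e3 : Complex.exp (t * (c / 2)) * Complex.exp (-(t * (c / 2))) = 1 := by
    rw [← Complex.exp_add]; simp
  rw [e1, e2, slope_def_field]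
  simp only [zero_mul, neg_zero, Complex.exp_zero, sub_self, sub_zero, div_pow]
  congr 1
  linear_combination (-2 : ℂ) * e3

lemma tendsto_trc_sub_two_div_sq {n : ℕ} (a : Fin n → ℂ) (x : H n) :
    Tendsto (fun t : ℂ => (trc x - 2 : FR n) (diagRep (t • a)) / t ^ 2)
      (𝓝[≠] 0) (𝓝 (pairing a x ^ 2)) := by
  refine (tendsto_exp_add_exp_neg_sub_two_div_sq (pairing a x)).congr fun t => ?_
  rw [Pi.sub_apply, trc_diagRep, pairing_smul]
  rfl

lemma exists_tendsto_of_mem_Xring {n : ℕ} (a : Fin n → ℂ) {f : FR n} (hf : f ∈ Xring n) :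
    ∃ l, Tendsto (fun t : ℂ => f (diagRep (t • a))) (𝓝[≠] 0) (𝓝 l) := by
  induction hf using Algebra.adjoin_induction with
  | mem f hf =>
    obtain ⟨x, rfl⟩ := hf
    have h : Continuous fun t : ℂ => trc x (diagRep (t • a)) := by
      simp only [trc_diagRep, pairing_smul]
      fun_prop
    exact ⟨_, (h.tendsto 0).mono_left nhdsWithin_le_nhds⟩
  | algebraMap r => exact ⟨_, tendsto_const_nhds⟩
  | add f g _ _ hf hg =>
    obtain ⟨l, hl⟩ := hf
    obtain ⟨m, hm⟩ := hg
    exact ⟨_, hl.add hm⟩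
  | mul f g _ _ hf hg =>
    obtain ⟨l, hl⟩ := hf
    obtain ⟨m, hm⟩ := hg
    exact ⟨_, hl.mul hm⟩

lemma exists_tendsto_div_sq_of_mem_Jideal {n : ℕ} (a : Fin n → ℂ) {f : Xring n}
    (hf : f ∈ Jideal n) :
    ∃ l, Tendsto (fun t : ℂ => (f : FR n) (diagRep (t • a)) / t ^ 2) (𝓝[≠] 0) (𝓝 l) := by
  induction hf using Submodule.span_induction with
  | mem f hf =>
    obtain ⟨x, hx⟩ := hf
    rw [hx]
    exact ⟨_, tendsto_trc_sub_two_div_sq a x⟩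
  | zero => exact ⟨0, by simp⟩
  | add f g _ _ hf hg =>
    obtain ⟨l, hl⟩ := hf
    obtain ⟨m, hm⟩ := hg
    exact ⟨_, (hl.add hm).congr fun t => by simp [add_div]⟩
  | smul r f _ hf =>
    obtain ⟨l, hl⟩ := exists_tendsto_of_mem_Xring a r.2
    obtain ⟨m, hm⟩ := hf
    exact ⟨_, (hl.mul hm).congr fun t => by simp [mul_div_assoc]⟩

lemma tendsto_div_sq_of_mem_Jideal_sq {n : ℕ} (a : Fin n → ℂ) {f : Xring n}
    (hf : f ∈ Jideal n ^ 2) :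
    Tendsto (fun t : ℂ => (f : FR n) (diagRep (t • a)) / t ^ 2) (𝓝[≠] 0) (𝓝 0) := by
  rw [pow_two] at hf
  induction hf using Submodule.mul_induction_on' with
  | mem_mul_mem f hf g hg =>
    obtain ⟨l, hl⟩ := exists_tendsto_div_sq_of_mem_Jideal a hf
    obtain ⟨m, hm⟩ := exists_tendsto_div_sq_of_mem_Jideal a hg
    have ht : Tendsto (fun t : ℂ => t ^ 2) (𝓝[≠] 0) (𝓝 0) := by
      simpa using ((continuous_pow 2).tendsto (0 : ℂ)).mono_left nhdsWithin_le_nhds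
    have h := (hl.mul hm).mul ht
    rw [mul_zero] at h
    refine h.congr' ?_
    filter_upwards [self_mem_nhdsWithin] with t ht0
    have ht0 : t ≠ 0 := ht0
    simp only [MulMemClass.coe_mul, Pi.mul_apply]
    field_simp
  | add f _ g _ hf hg =>
    have h := hf.add hg
    rw [add_zero] at h
    exact h.congr fun t => by simp [add_div]

lemma trc'_mem_Jideal {n : ℕ} (x : H n) : trc' x ∈ Jideal n :=
  Ideal.subset_span ⟨x, rfl⟩

lemma coe_trc' {n : ℕ} (x : H n) : (trc' x : FR n) = trc x - 2 := rfl

lemma actRH_trc' {n : ℕ} (σ : MulAut (H n)) (x : H n) :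
    actRH n σ (trc' x : FR n) = trc (σ x) - 2 := rfl

lemma pairing_sq_eq_of_mem_EH {n k : ℕ} (hk : 1 ≤ k) {σ : MulAut (H n)} (hσ : σ ∈ EH n k)
    (a : Fin n → ℂ) (x : H n) : pairing a (σ x) ^ 2 = pairing a x ^ 2 := by
  obtain ⟨g, hg, hgx⟩ := hσ (trc' x) (trc'_mem_Jideal x)
  have h0 := tendsto_div_sq_of_mem_Jideal_sq a
    (Ideal.pow_le_pow_right (by lia : 2 ≤ k + 1) hg)
  have h1 := (tendsto_trc_sub_two_div_sq a (σ x)).sub (tendsto_trc_sub_two_div_sq a x)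
  refine sub_eq_zero.1 (tendsto_nhds_unique (h1.congr fun t => ?_) h0)
  rw [hgx, ← sub_div, Pi.sub_apply, Pi.sub_apply, Pi.sub_apply, actRH_trc', Pi.sub_apply, coe_trc',
    Pi.sub_apply]

lemma eq_or_eq_neg_of_mul_eq_mul {ι : Type*} {x y : ι → ℤ}
    (h : ∀ i j, y i * y j = x i * x j) : y = x ∨ y = -x := by
  by_contra! hne
  obtain ⟨i, hi⟩ := Function.ne_iff.1 hne.1
  obtain ⟨j, hj⟩ := Function.ne_iff.1 hne.2
  have hi' : y i = -x i := (mul_self_eq_mul_self_iff.1 (h i i)).resolve_left hi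
  have hj' : y j = x j := (mul_self_eq_mul_self_iff.1 (h j j)).resolve_right hj
  have hij := h i j
  rw [Pi.neg_apply] at hj
  rw [hi', hj', neg_mul, neg_eq_iff_add_eq_zero, ← two_mul] at hij
  rcases mul_eq_zero.1 (mul_eq_zero.1 hij |>.resolve_left two_ne_zero) with h | h <;> lia

lemma apply_eq_or_eq_inv_of_mem_EH {n k : ℕ} (hk : 1 ≤ k) {σ : MulAut (H n)}
    (hσ : σ ∈ EH n k) (x : H n) : σ x = x ∨ σ x = x⁻¹ := by
  refine eq_or_eq_neg_of_mul_eq_mul (x := x.toAdd) (y := (σ x).toAdd) fun i j => ?_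
  have hi := pairing_sq_eq_of_mem_EH hk hσ (Pi.single i 1) x
  have hj := pairing_sq_eq_of_mem_EH hk hσ (Pi.single j 1) x
  have hij := pairing_sq_eq_of_mem_EH hk hσ (Pi.single i 1 + Pi.single j 1) x
  simp only [pairing_add, pairing_single] at hi hj hij
  have h : ((σ x).toAdd i : ℂ) * (σ x).toAdd j = x.toAdd i * x.toAdd j := by
    linear_combination (hij - hi - hj) / 2
  exact_mod_cast h

lemma eq_refl_or_eq_inv_of_forall {G : Type*} [CommGroup G] [IsMulTorsionFree G]
    (σ : MulAut G) (h : ∀ x, σ x = x ∨ σ x = x⁻¹) :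
    σ = MulEquiv.refl G ∨ σ = MulEquiv.inv G := by
  by_contra! hne
  obtain ⟨x, hx⟩ := DFunLike.ne_iff.1 hne.1
  obtain ⟨y, hy⟩ := DFunLike.ne_iff.1 hne.2
  have hx' : σ x = x⁻¹ := (h x).resolve_left hx
  have hy' : σ y = y := (h y).resolve_right hy
  rcases h (x * y) with hxy | hxy
  · rw [map_mul, hx', hy', mul_left_inj] at hxy
    exact hx (hx'.trans hxy)
  · rw [map_mul, hx', hy', mul_inv, mul_right_inj] at hxy
    exact hy (hy'.trans hxy)

lemma trc_inv {n : ℕ} (x : H n) : trc x⁻¹ = trc x := by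
  ext ρ
  simp [trc, Matrix.SpecialLinearGroup.coe_inv, Matrix.adjugate_fin_two, Matrix.trace_fin_two,
    add_comm]

lemma actRH_inv_aut_of_mem_Xring {n : ℕ} {f : FR n} (hf : f ∈ Xring n) :
    actRH n (inv_aut n) f = f := by
  induction hf using Algebra.adjoin_induction with
  | mem f hf =>
    obtain ⟨x, rfl⟩ := hf
    exact trc_inv x
  | algebraMap r => rfl
  | add f g _ _ hf hg => rw [map_add, hf, hg]
  | mul f g _ _ hf hg => rw [map_mul, hf, hg]

lemma mem_EH_of_forall {n : ℕ} (k : ℕ) {σ : MulAut (H n)}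
    (h : ∀ f ∈ Xring n, actRH n σ f = f) : σ ∈ EH n k := fun f _ =>
  ⟨0, zero_mem _, by rw [h _ f.2, sub_self]; rfl⟩

lemma EH_eq_pair (n : ℕ) {k : ℕ} (hk : 1 ≤ k) :
    EH n k = {MulEquiv.refl (H n), inv_aut n} := by
  refine Set.Subset.antisymm (fun σ hσ => ?_) ?_
  · exact eq_refl_or_eq_inv_of_forall σ (apply_eq_or_eq_inv_of_mem_EH hk hσ)
  · rintro σ (rfl | rfl)
    · exact mem_EH_of_forall k fun _ _ => rfl
    · exact mem_EH_of_forall k fun _ hf => actRH_inv_aut_of_mem_Xring hf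

/-- **Proposition 5.1 and Corollary 5.2**: for every `k ≥ 1`, `E_H(k) = E_H(1) = {id, ι}`;
that is, an automorphism of `H` acts trivially on `J/J^{k+1}` if and only if it is the identity
or the inversion automorphism `ι`. -/
theorem EH_eq_EH_one (n : ℕ) (hn : 1 ≤ n) (k : ℕ) (hk : 1 ≤ k) :
    EH n k = EH n 1 ∧ EH n k = {MulEquiv.refl (H n), inv_aut n} :=
  ⟨(EH_eq_pair n hk).trans (EH_eq_pair n le_rfl).symm, EH_eq_pair n hk⟩
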